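/- Let G be a countable sofic group with sofic approximation sequence Σ, let k ∈ ℕ, let X = {0,1,…,k−1}^G with the product topology and the left shift action s·(x_t)_{t∈G} = (x_{s^{-1}t})_{t∈G}, let a_0,…,a_{k−1} ∈ ℝ, and define f ∈ C(X) by f(x) = a_{x_e}. Let μ be the probability measure on {0,…,k−1} given by μ(i) = exp(a_i)/Σ_{j=0}^{k−1} exp(a_j), and let μ^G be the product (Bernoulli) measure on X. Then μ^G is a G-invariant Borel probability measure and is an equilibrium state for f with respect to Σ: h_{Σ,μ^G}(X,G) + ∫_X f dμ^G = P_Σ(f,X,G) = log(Σ_{j=0}^{k−1} exp(a_j)). -/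

import Mathlib

open Filter MeasureTheory
open scoped Pointwise Classical BigOperators

namespace Sofic

structure ContAction (G : Type*) [Group G] (X : Type*) [TopologicalSpace X]
    (α : G → X → X) : Prop where
  one : ∀ x, α 1 x = x
  mul : ∀ s t x, α (s * t) x = α s (α t x)
  cont : ∀ s, Continuous (α s)

structure IsContPseudoMetric (X : Type*) [TopologicalSpace X] (ρ : X → X → ℝ) : Prop where
  nonneg : ∀ x y, 0 ≤ ρ x y
  refl : ∀ x, ρ x x = 0
  symm : ∀ x y, ρ x y = ρ y x
  triangle : ∀ x y z, ρ x z ≤ ρ x y + ρ y z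
  cont : Continuous fun p : X × X => ρ p.1 p.2

structure IsCompatMetric (X : Type*) [TopologicalSpace X] (ρ : X → X → ℝ)
    extends IsContPseudoMetric X ρ : Prop where
  eq_of_zero : ∀ x y, ρ x y = 0 → x = y
  ball_mem : ∀ x : X, ∀ U ∈ nhds x, ∃ ε > 0, {y | ρ x y < ε} ⊆ U

structure IsSoficApprox (G : Type*) [Group G] (d : ℕ → ℕ)
    (σ : ∀ i, G → Equiv.Perm (Fin (d i))) : Prop where
  mul : ∀ s t : G, Tendsto
    (fun i => ((Finset.univ.filter fun a : Fin (d i) => σ i s (σ i t a) = σ i (s * t) a).card : ℝ) / (d i : ℝ))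
    atTop (nhds 1)
  sep : ∀ s t : G, s ≠ t → Tendsto
    (fun i => ((Finset.univ.filter fun a : Fin (d i) => σ i s a ≠ σ i t a).card : ℝ) / (d i : ℝ))
    atTop (nhds 1)
  dim_top : Tendsto d atTop atTop

noncomputable def rho2 {X : Type*} (ρ : X → X → ℝ) {d : ℕ} (φ ψ : Fin d → X) : ℝ :=
  Real.sqrt ((1 / (d : ℝ)) * ∑ a, (ρ (φ a) (ψ a)) ^ 2)

noncomputable def rhoInf {X : Type*} (ρ : X → X → ℝ) {d : ℕ} (φ ψ : Fin d → X) : ℝ :=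
  ⨆ a : Fin d, ρ (φ a) (ψ a)

def MapSet {G X : Type*} [Group G] (α : G → X → X) (ρ : X → X → ℝ)
    (F : Finset G) (δ : ℝ) {d : ℕ} (σ : G → Equiv.Perm (Fin d)) : Set (Fin d → X) :=
  {φ | ∀ s ∈ F, rho2 ρ (fun a => α s (φ a)) (fun a => φ (σ s a)) < δ}

noncomputable def Mval {G X : Type*} [Group G] (α : G → X → X) (f : X → ℝ) (ρ : X → X → ℝ)
    (ε : ℝ) (F : Finset G) (δ : ℝ) {d : ℕ} (σ : G → Equiv.Perm (Fin d))
    (sepd : (Fin d → X) → (Fin d → X) → ℝ) : ℝ :=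
  sSup {r : ℝ | ∃ E : Finset (Fin d → X), ↑E ⊆ MapSet α ρ F δ σ ∧
    (∀ φ ∈ E, ∀ ψ ∈ E, φ ≠ ψ → ε ≤ sepd φ ψ) ∧
    r = ∑ φ ∈ E, Real.exp (∑ a, f (φ a))}

noncomputable def PressureInf {G X : Type*} [Group G] (α : G → X → X) (f : X → ℝ)
    (ρ : X → X → ℝ) (d : ℕ → ℕ) (σ : ∀ i, G → Equiv.Perm (Fin (d i))) : EReal :=
  ⨆ (ε : ℝ) (_ : 0 < ε), ⨅ (F : Finset G) (_ : F.Nonempty), ⨅ (δ : ℝ) (_ : 0 < δ),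
    Filter.limsup (fun i =>
      if (MapSet α ρ F δ (σ i)).Nonempty then
        (((Real.log (Mval α f ρ ε F δ (σ i) (rhoInf ρ))) / (d i : ℝ) : ℝ) : EReal)
      else (⊥ : EReal)) atTop

noncomputable def Pressure2 {G X : Type*} [Group G] (α : G → X → X) (f : X → ℝ)
    (ρ : X → X → ℝ) (d : ℕ → ℕ) (σ : ∀ i, G → Equiv.Perm (Fin (d i))) : EReal :=
  ⨆ (ε : ℝ) (_ : 0 < ε), ⨅ (F : Finset G) (_ : F.Nonempty), ⨅ (δ : ℝ) (_ : 0 < δ),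
    Filter.limsup (fun i =>
      if (MapSet α ρ F δ (σ i)).Nonempty then
        (((Real.log (Mval α f ρ ε F δ (σ i) (rho2 ρ))) / (d i : ℝ) : ℝ) : EReal)
      else (⊥ : EReal)) atTop

def MapMuSet {G X : Type*} [Group G] [TopologicalSpace X] [MeasurableSpace X]
    (α : G → X → X) (μ : Measure X) (ρ : X → X → ℝ) (F : Finset G)
    (L : Finset C(X, ℝ)) (δ : ℝ) {d : ℕ} (σ : G → Equiv.Perm (Fin d)) : Set (Fin d → X) :=
  {φ | φ ∈ MapSet α ρ F δ σ ∧
    ∀ g ∈ L, |(1 / (d : ℝ)) * ∑ j, g (φ j) - ∫ x, g x ∂μ| < δ}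

noncomputable def Nval {X : Type*} (ε : ℝ) {d : ℕ} (Y : Set (Fin d → X))
    (sepd : (Fin d → X) → (Fin d → X) → ℝ) : ℝ :=
  sSup {r : ℝ | ∃ E : Finset (Fin d → X), ↑E ⊆ Y ∧
    (∀ φ ∈ E, ∀ ψ ∈ E, φ ≠ ψ → ε ≤ sepd φ ψ) ∧ r = (E.card : ℝ)}

noncomputable def MeasEntropy {G X : Type*} [Group G] [TopologicalSpace X] [MeasurableSpace X]
    (α : G → X → X) (μ : Measure X) (ρ : X → X → ℝ) (d : ℕ → ℕ)
    (σ : ∀ i, G → Equiv.Perm (Fin (d i))) : EReal :=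
  ⨆ (ε : ℝ) (_ : 0 < ε), ⨅ (F : Finset G) (_ : F.Nonempty),
    ⨅ (L : Finset C(X, ℝ)) (_ : L.Nonempty), ⨅ (δ : ℝ) (_ : 0 < δ),
      Filter.limsup (fun i =>
        if (MapMuSet α μ ρ F L δ (σ i)).Nonempty then
          (((Real.log (Nval ε (MapMuSet α μ ρ F L δ (σ i)) (rhoInf ρ))) / (d i : ℝ) : ℝ) : EReal)
        else (⊥ : EReal)) atTop

def IsInvProb {G X : Type*} [Group G] [MeasurableSpace X]
    (α : G → X → X) (μ : Measure X) : Prop :=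
  IsProbabilityMeasure μ ∧ ∀ s : G, Measure.map (α s) μ = μ

noncomputable def Kval {G X : Type*} [Group G] (α : G → X → X) (f : X → ℝ)
    (ρ : X → X → ℝ) (ε : ℝ) (F : Finset G) : ℝ :=
  sSup {r : ℝ | ∃ D : Finset X,
    (∀ x ∈ D, ∀ y ∈ D, x ≠ y → ε ≤ ⨆ s ∈ F, ρ (α s x) (α s y)) ∧
    r = ∑ x ∈ D, Real.exp (∑ s ∈ F, f (α s x))}

def IsFolnerSeq (G : Type*) [Group G] [DecidableEq G] (Fol : ℕ → Finset G) : Prop :=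
  (∀ n, (Fol n).Nonempty) ∧ ∀ s : G,
    Tendsto (fun n =>
      (((((Fol n).image fun t => s * t) \ Fol n) ∪ (Fol n \ ((Fol n).image fun t => s * t))).card : ℝ)
        / ((Fol n).card : ℝ)) atTop (nhds 0)

section Configurations

variable {G K : Type*} [TopologicalSpace K] [DiscreteTopology K]

lemma isClopen_agree (t : G) : IsClopen {p : (G → K) × (G → K) | p.1 t = p.2 t} := by
  have : Continuous fun p : (G → K) × (G → K) => (p.1 t, p.2 t) := by fun_prop
  exact (isClopen_discrete {q : K × K | q.1 = q.2}).preimage this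

lemma exists_finset_agree_lt [Finite K] {D : (G → K) → (G → K) → ℝ}
    (hD : Continuous fun p : (G → K) × (G → K) => D p.1 p.2) (hD0 : ∀ x, D x x = 0)
    {ε : ℝ} (hε : 0 < ε) :
    ∃ A : Finset G, ∀ x y, (∀ t ∈ A, x t = y t) → D x y < ε := by
  have hK : IsCompact {p : (G → K) × (G → K) | ε ≤ D p.1 p.2} :=
    (isClosed_le continuous_const hD).isCompact
  obtain ⟨A, hA⟩ := hK.elim_finite_subfamily_closed
    (fun t : G => {p : (G → K) × (G → K) | p.1 t = p.2 t})
    (fun t => (isClopen_agree t).isClosed) (by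
      ext ⟨x, y⟩
      simp only [Set.mem_inter_iff, Set.mem_ofPred_eq, Set.mem_iInter, Set.mem_empty_iff_false,
        iff_false, not_and]
      intro h h'
      obtain rfl : x = y := funext h'
      rw [hD0] at h
      linarith)
  refine ⟨A, fun x y hxy => ?_⟩
  by_contra! h
  have : (x, y) ∈ ({p : (G → K) × (G → K) | ε ≤ D p.1 p.2} ∩
      ⋂ t ∈ A, {p : (G → K) × (G → K) | p.1 t = p.2 t}) := by
    simpa using ⟨h, hxy⟩
  simp [hA] at this

lemma exists_pos_le_of_ne [Finite K] {ρ : (G → K) → (G → K) → ℝ}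
    (hρ : IsCompatMetric (G → K) ρ) (t : G) :
    ∃ ε > 0, ∀ x y, x t ≠ y t → ε ≤ ρ x y := by
  have hK : IsCompact {p : (G → K) × (G → K) | p.1 t = p.2 t}ᶜ :=
    (isClopen_agree t).compl.isClosed.isCompact
  obtain ⟨ε, hε, h⟩ := hK.exists_forall_le' (a := 0) hρ.cont.continuousOn (by
    rintro ⟨x, y⟩ hxy
    refine (hρ.nonneg x y).lt_of_ne fun h => hxy ?_
    have := hρ.eq_of_zero x y h.symm
    simp [this])
  exact ⟨ε, hε, fun x y hxy => h (x, y) hxy⟩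

lemma rhoInf_lt {X : Type*} {ρ : X → X → ℝ} {ε : ℝ} (hε : 0 < ε) {d : ℕ} {φ ψ : Fin d → X}
    (h : ∀ j, ρ (φ j) (ψ j) < ε) : rhoInf ρ φ ψ < ε := by
  unfold rhoInf
  rcases isEmpty_or_nonempty (Fin d) with hd | hd
  · simpa using hε
  · obtain ⟨j, hj⟩ := exists_eq_ciSup_of_finite (f := fun j => ρ (φ j) (ψ j))
    rw [← hj]
    exact h j

lemma le_rhoInf {X : Type*} {ρ : X → X → ℝ} {ε : ℝ} {d : ℕ} {φ ψ : Fin d → X}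
    (j : Fin d) (h : ε ≤ ρ (φ j) (ψ j)) : ε ≤ rhoInf ρ φ ψ :=
  h.trans (le_ciSup (f := fun j => ρ (φ j) (ψ j)) (Set.finite_range _).bddAbove j)

lemma exists_card_le_of_separated [Fintype K] {ρ : (G → K) → (G → K) → ℝ}
    (hρ : IsCompatMetric (G → K) ρ) {ε : ℝ} (hε : 0 < ε) (d : ℕ) :
    ∃ N : ℕ, ∀ E : Finset (Fin d → G → K),
      (∀ φ ∈ E, ∀ ψ ∈ E, φ ≠ ψ → ε ≤ rhoInf ρ φ ψ) → E.card ≤ N := by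
  obtain ⟨A, hA⟩ := exists_finset_agree_lt hρ.cont hρ.refl hε
  refine ⟨Fintype.card (Fin d → A → K), fun E hE => ?_⟩
  rw [← Finset.card_univ]
  refine Finset.card_le_card_of_injOn (fun φ j t => φ j t)
    (fun _ _ => Finset.mem_coe.2 (Finset.mem_univ _)) ?_
  intro φ hφ ψ hψ h
  by_contra hne
  refine (hE φ hφ ψ hψ hne).not_gt (rhoInf_lt hε fun j => hA _ _ fun t ht => ?_)
  exact congrFun (congrFun h j) ⟨t, ht⟩

lemma bddAbove_Nval [Fintype K] {ρ : (G → K) → (G → K) → ℝ}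
    (hρ : IsCompatMetric (G → K) ρ) {ε : ℝ} (hε : 0 < ε) {d : ℕ} (Y : Set (Fin d → G → K)) :
    BddAbove {r : ℝ | ∃ E : Finset (Fin d → G → K), ↑E ⊆ Y ∧
      (∀ φ ∈ E, ∀ ψ ∈ E, φ ≠ ψ → ε ≤ rhoInf ρ φ ψ) ∧ r = (E.card : ℝ)} := by
  obtain ⟨N, hN⟩ := exists_card_le_of_separated hρ hε d
  refine ⟨N, ?_⟩
  rintro _ ⟨E, -, hE, rfl⟩
  exact_mod_cast hN E hE

lemma bddAbove_Mval [Fintype K] [Group G] {ρ : (G → K) → (G → K) → ℝ}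
    (hρ : IsCompatMetric (G → K) ρ) {ε : ℝ} (hε : 0 < ε) {d : ℕ}
    (α : G → (G → K) → G → K) (F : Finset G) (δ : ℝ) (σ : G → Equiv.Perm (Fin d))
    {f : (G → K) → ℝ} {C : ℝ} (hf : ∀ x, f x ≤ C) :
    BddAbove {r : ℝ | ∃ E : Finset (Fin d → G → K), ↑E ⊆ MapSet α ρ F δ σ ∧
      (∀ φ ∈ E, ∀ ψ ∈ E, φ ≠ ψ → ε ≤ rhoInf ρ φ ψ) ∧
      r = ∑ φ ∈ E, Real.exp (∑ j, f (φ j))} := by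
  obtain ⟨N, hN⟩ := exists_card_le_of_separated hρ hε d
  refine ⟨N * Real.exp (d * C), ?_⟩
  rintro _ ⟨E, -, hE, rfl⟩
  calc ∑ φ ∈ E, Real.exp (∑ j, f (φ j)) ≤ E.card • Real.exp (d * C) := by
        refine Finset.sum_le_card_nsmul _ _ _ fun φ _ => Real.exp_le_exp.2 ?_
        calc ∑ j, f (φ j) ≤ ∑ _j : Fin d, C := Finset.sum_le_sum fun j _ => hf _
          _ = d * C := by simp
    _ ≤ N * Real.exp (d * C) := by
        rw [nsmul_eq_mul]
        gcongr
        exact hN E hE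

lemma card_mul_sq_le_of_rho2_lt {X : Type*} {ρ : X → X → ℝ} {d : ℕ} {φ ψ : Fin d → X} {δ ε : ℝ}
    (hδ : rho2 ρ φ ψ < δ) (hε : 0 < ε) (J : Finset (Fin d))
    (hJ : ∀ j ∈ J, ε ≤ ρ (φ j) (ψ j)) : (J.card : ℝ) * ε ^ 2 ≤ d * δ ^ 2 := by
  rcases Nat.eq_zero_or_pos d with rfl | hd
  · simp [Finset.eq_empty_of_isEmpty J]
  have hd' : (0 : ℝ) < d := by exact_mod_cast hd
  have h1 : 1 / (d : ℝ) * ∑ j, ρ (φ j) (ψ j) ^ 2 < δ ^ 2 := Real.lt_sq_of_sqrt_lt hδ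
  have h2 : (J.card : ℝ) * ε ^ 2 ≤ ∑ j, ρ (φ j) (ψ j) ^ 2 :=
    calc (J.card : ℝ) * ε ^ 2 = ∑ _j ∈ J, ε ^ 2 := by simp
      _ ≤ ∑ j ∈ J, ρ (φ j) (ψ j) ^ 2 :=
        Finset.sum_le_sum fun j hj => pow_le_pow_left₀ hε.le (hJ j hj) 2
      _ ≤ _ := Finset.sum_le_sum_of_subset_of_nonneg (Finset.subset_univ _)
        fun _ _ _ => sq_nonneg _
  rw [one_div, inv_mul_lt_iff₀ hd'] at h1
  linarith

lemma sum_exp_le_of_injOn {K L Φ : Type*} [Fintype K] [Nonempty K] [Fintype L] {d : ℕ}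
    (E : Finset Φ) (c : Φ → Fin d → K) (u : Φ → Fin d → L) (bad : Φ → Finset (Fin d))
    (b : K → ℝ) {T κ : ℝ}
    (hcode : Set.InjOn (fun φ j => (c φ j, if j ∈ bad φ then some (u φ j) else none)) E)
    (hbad : ∀ φ ∈ E, T * (bad φ).card ≤ d * (κ / 2))
    (hT : Fintype.card L * Real.exp (-T) ≤ κ / 2) :
    ∑ φ ∈ E, Real.exp (∑ j, b (c φ j)) ≤
      Real.exp (d * (Real.log (∑ c, Real.exp (b c)) + κ)) := by
  set Z : ℝ := ∑ c, Real.exp (b c) with hZ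
  have hZpos : 0 < Z := Finset.sum_pos (fun _ _ => Real.exp_pos _) Finset.univ_nonempty
  set code : Φ → Fin d → K × Option L :=
    fun φ j => (c φ j, if j ∈ bad φ then some (u φ j) else none) with hcode_def
  let w : K × Option L → ℝ := fun q =>
    Real.exp (b q.1) * q.2.elim 1 fun _ => Real.exp (-T)
  have hw0 : ∀ q, 0 ≤ w q := by
    rintro ⟨c, _ | u⟩ <;> simp only [w, Option.elim] <;> positivity
  have hw : ∑ q, w q = Z * (1 + Fintype.card L * Real.exp (-T)) := by
    simp only [w, Fintype.sum_prod_type, ← Finset.mul_sum, Fintype.sum_option, Option.elim,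
      Finset.sum_const, Finset.card_univ, nsmul_eq_mul, ← Finset.sum_mul]
    rfl
  have hterm : ∀ φ ∈ E, Real.exp (∑ j, b (c φ j)) ≤
      Real.exp (d * (κ / 2)) * ∏ j, w (code φ j) := by
    intro φ hφ
    have h1 : ∏ j, w (code φ j) =
        Real.exp (∑ j, b (c φ j)) * Real.exp (-(T * (bad φ).card)) := by
      have h2 : ∀ j, w (code φ j) =
          Real.exp (b (c φ j)) * if j ∈ bad φ then Real.exp (-T) else 1 := by
        intro j
        by_cases hj : j ∈ bad φ <;> simp [w, code, hj]
      rw [Finset.prod_congr rfl fun j _ => h2 j, Finset.prod_mul_distrib, ← Real.exp_sum,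
        Finset.prod_ite_mem, Finset.univ_inter, Finset.prod_const, ← Real.exp_nat_mul]
      congr 2
      ring
    rw [h1, ← Real.exp_add, ← Real.exp_add]
    exact Real.exp_le_exp.2 (by linarith [hbad φ hφ])
  calc ∑ φ ∈ E, Real.exp (∑ j, b (c φ j))
      ≤ ∑ φ ∈ E, Real.exp (d * (κ / 2)) * ∏ j, w (code φ j) := Finset.sum_le_sum hterm
    _ = Real.exp (d * (κ / 2)) * ∑ q ∈ E.image code, ∏ j, w (q j) := by
        rw [Finset.sum_image hcode, Finset.mul_sum]
    _ ≤ Real.exp (d * (κ / 2)) * ∑ q : Fin d → K × Option L, ∏ j, w (q j) := by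
        gcongr
        · exact fun q _ _ => Finset.prod_nonneg fun j _ => hw0 _
        · exact Finset.subset_univ _
    _ = Real.exp (d * (κ / 2)) * (Z * (1 + Fintype.card L * Real.exp (-T))) ^ d := by
        rw [← hw, Fintype.sum_pow]
    _ ≤ Real.exp (d * (κ / 2)) * (Real.exp (Real.log Z) * Real.exp (κ / 2)) ^ d := by
        rw [Real.exp_log hZpos]
        gcongr
        linarith [Real.add_one_le_exp (κ / 2)]
    _ = _ := by
        rw [← Real.exp_add, ← Real.exp_nat_mul, ← Real.exp_add]
        congr 1
        ring

lemma exists_sum_exp_le [Fintype K] [Nonempty K] [Group G] {ρ : (G → K) → (G → K) → ℝ}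
    (hρ : IsCompatMetric (G → K) ρ) {α : G → (G → K) → G → K}
    (hα : ∀ (s : G) (x : G → K) (t : G), α s x t = x (s⁻¹ * t)) (b : K → ℝ)
    {ε κ : ℝ} (hε : 0 < ε) (hκ : 0 < κ) :
    ∃ F : Finset G, F.Nonempty ∧ ∃ δ > 0, ∀ (d : ℕ) (σ : G → Equiv.Perm (Fin d))
      (E : Finset (Fin d → G → K)), ↑E ⊆ MapSet α ρ F δ σ →
      (∀ φ ∈ E, ∀ ψ ∈ E, φ ≠ ψ → ε ≤ rhoInf ρ φ ψ) →
      ∑ φ ∈ E, Real.exp (∑ j, b (φ j 1)) ≤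
        Real.exp (d * (Real.log (∑ c, Real.exp (b c)) + κ)) := by
  obtain ⟨A, hA⟩ := exists_finset_agree_lt hρ.cont hρ.refl hε
  obtain ⟨ε₀, hε₀, hsep⟩ := exists_pos_le_of_ne hρ (1 : G)
  set N : ℝ := (Fintype.card (A → K) : ℝ) with hN
  have hNpos : 0 < N := by
    rw [hN]; exact_mod_cast Fintype.card_pos
  set T : ℝ := 2 * N / κ with hT
  have hTpos : 0 < T := by positivity
  have hNT : N * Real.exp (-T) ≤ κ / 2 := by
    rw [Real.exp_neg, ← div_eq_mul_inv, div_le_iff₀ (Real.exp_pos _)]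
    have : κ * T = 2 * N := by rw [hT]; field_simp
    nlinarith [Real.add_one_le_exp T]
  set δ : ℝ := Real.sqrt (ε₀ ^ 2 * κ / (2 * (A.card * T + 1))) with hδ
  have hδpos : 0 < δ := Real.sqrt_pos.2 (by positivity)
  have hδsq : δ ^ 2 = ε₀ ^ 2 * κ / (2 * (A.card * T + 1)) := Real.sq_sqrt (by positivity)
  refine ⟨insert 1 (A.image (·⁻¹)), Finset.insert_nonempty _ _, δ, hδpos, fun d σ E hE hEsep => ?_⟩
  let bad : (Fin d → G → K) → Finset (Fin d) := fun φ =>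
    A.biUnion fun t => Finset.univ.filter fun j => α t⁻¹ (φ j) 1 ≠ φ (σ t⁻¹ j) 1
  have hgood : ∀ φ j, j ∉ bad φ → ∀ t ∈ A, φ j t = φ (σ t⁻¹ j) 1 := by
    intro φ j hj t ht
    simp only [bad, Finset.mem_biUnion, Finset.mem_filter, Finset.mem_univ, true_and, not_exists,
      not_and, not_not] at hj
    rw [← hj t ht, hα]
    simp
  have hbad : ∀ φ ∈ E, T * (bad φ).card ≤ d * (κ / 2) := by
    intro φ hφ
    have h1 : ((bad φ).card : ℝ) ≤ ∑ t ∈ A,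
        ((Finset.univ.filter fun j => α t⁻¹ (φ j) 1 ≠ φ (σ t⁻¹ j) 1).card : ℝ) := by
      exact_mod_cast Finset.card_biUnion_le
    have h2 : ((bad φ).card : ℝ) * ε₀ ^ 2 ≤ A.card * (d * δ ^ 2) := by
      calc ((bad φ).card : ℝ) * ε₀ ^ 2 ≤ (∑ t ∈ A,
          ((Finset.univ.filter fun j => α t⁻¹ (φ j) 1 ≠ φ (σ t⁻¹ j) 1).card : ℝ)) * ε₀ ^ 2 := by
            gcongr
        _ = ∑ t ∈ A, ((Finset.univ.filter fun j =>
            α t⁻¹ (φ j) 1 ≠ φ (σ t⁻¹ j) 1).card : ℝ) * ε₀ ^ 2 := Finset.sum_mul _ _ _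
        _ ≤ ∑ _t ∈ A, d * δ ^ 2 := by
            refine Finset.sum_le_sum fun t ht => ?_
            refine card_mul_sq_le_of_rho2_lt (hE hφ t⁻¹ ?_) hε₀ _ ?_
            · exact Finset.mem_insert_of_mem (Finset.mem_image_of_mem _ ht)
            · intro j hj
              exact hsep _ _ (Finset.mem_filter.1 hj).2
        _ = _ := by simp
    have h3 : A.card * T * δ ^ 2 ≤ ε₀ ^ 2 * (κ / 2) := by
      have h4 : (A.card * T + 1) * δ ^ 2 = ε₀ ^ 2 * (κ / 2) := by
        rw [hδsq]; field_simp
      nlinarith [sq_nonneg δ]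
    have h5 : 0 < ε₀ ^ 2 := by positivity
    refine le_of_mul_le_mul_right ?_ h5
    calc T * (bad φ).card * ε₀ ^ 2 = T * ((bad φ).card * ε₀ ^ 2) := by ring
      _ ≤ T * (A.card * (d * δ ^ 2)) := by gcongr
      _ = d * (A.card * T * δ ^ 2) := by ring
      _ ≤ d * (ε₀ ^ 2 * (κ / 2)) := by gcongr
      _ = _ := by ring
  refine sum_exp_le_of_injOn E (fun φ j => φ j 1) (fun φ j (t : A) => φ j t) bad b ?_ hbad hNT
  · intro φ hφ ψ hψ h
    by_contra hne
    refine (hEsep φ hφ ψ hψ hne).not_gt (rhoInf_lt hε fun j => hA _ _ fun t ht => ?_)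
    have hfst : ∀ l, φ l 1 = ψ l 1 := fun l => congrArg Prod.fst (congrFun h l)
    have hsnd : (if j ∈ bad φ then some fun t : A => φ j t else none) =
        if j ∈ bad ψ then some fun t : A => ψ j t else none := congrArg Prod.snd (congrFun h j)
    by_cases h1 : j ∈ bad φ <;> by_cases h2 : j ∈ bad ψ <;> simp only [h1, h2, if_true, if_false,
      reduceCtorEq, Option.some.injEq] at hsnd
    · exact congrFun hsnd ⟨t, ht⟩
    · rw [hgood φ j h1 t ht, hgood ψ j h2 t ht, hfst]

end Configurations

section Densities

variable {d : ℕ → ℕ}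

lemma tendsto_card_filter_not_div (hd : Tendsto d atTop atTop) (P : ∀ i, Fin (d i) → Prop)
    [∀ i, DecidablePred (P i)]
    (h : Tendsto (fun i => ((Finset.univ.filter (P i)).card : ℝ) / (d i : ℝ)) atTop (nhds 1)) :
    Tendsto (fun i => ((Finset.univ.filter fun j => ¬ P i j).card : ℝ) / (d i : ℝ))
      atTop (nhds 0) := by
  have h' := h.const_sub 1
  rw [sub_self] at h'
  refine h'.congr' ?_
  filter_upwards [hd.eventually_gt_atTop 0] with i hi
  have h1 : (0 : ℝ) < d i := by exact_mod_cast hi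
  have h2 := Finset.card_filter_add_card_filter_not (s := Finset.univ) (P i)
  rw [Finset.card_univ, Fintype.card_fin] at h2
  have h3 : ((Finset.univ.filter (P i)).card : ℝ) +
      (Finset.univ.filter fun j => ¬ P i j).card = d i := by exact_mod_cast h2
  field_simp
  linarith

lemma tendsto_card_filter_exists_div {ι : Type*} (T : Finset ι) (Q : ι → ∀ i, Fin (d i) → Prop)
    [∀ t i, DecidablePred (Q t i)] [∀ i, DecidablePred fun j => ∃ t ∈ T, Q t i j]
    (h : ∀ t ∈ T, Tendsto (fun i => ((Finset.univ.filter (Q t i)).card : ℝ) / (d i : ℝ))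
      atTop (nhds 0)) :
    Tendsto (fun i => ((Finset.univ.filter fun j => ∃ t ∈ T, Q t i j).card : ℝ) / (d i : ℝ))
      atTop (nhds 0) := by
  have h' := tendsto_finsetSum T h
  rw [Finset.sum_const_zero] at h'
  refine squeeze_zero (fun i => by positivity) (fun i => ?_) h'
  rw [← Finset.sum_div]
  gcongr
  have : (Finset.univ.filter fun j => ∃ t ∈ T, Q t i j) =
      T.biUnion fun t => Finset.univ.filter (Q t i) := by
    ext j; simp
  rw [this]
  exact_mod_cast Finset.card_biUnion_le

end Densities

section Pullback

variable {G K : Type*} [Group G]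

/-- The pullback name of a colouring `ω` of `Fin d` along a map `σ : G → Sym(d)`. -/
def pullback {d : ℕ} (σ : G → Equiv.Perm (Fin d)) (ω : Fin d → K) (j : Fin d) : G → K :=
  fun t => ω (σ t⁻¹ j)

lemma sum_pullback_one {d : ℕ} (σ : G → Equiv.Perm (Fin d)) (ω : Fin d → K) (b : K → ℝ) :
    ∑ j, b (pullback σ ω j 1) = ∑ j, b (ω j) := by
  simp only [pullback, inv_one]
  exact Equiv.sum_comp (σ 1) fun j => b (ω j)

lemma exists_pullback_one_ne {d : ℕ} (σ : G → Equiv.Perm (Fin d)) {ω ω' : Fin d → K}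
    (h : ω ≠ ω') : ∃ j, pullback σ ω j 1 ≠ pullback σ ω' j 1 := by
  obtain ⟨l, hl⟩ := Function.ne_iff.1 h
  exact ⟨(σ 1).symm l, by simpa [pullback] using hl⟩

lemma pullback_injective {d : ℕ} (σ : G → Equiv.Perm (Fin d)) :
    Function.Injective (pullback σ : (Fin d → K) → Fin d → G → K) := by
  intro ω ω' h
  by_contra hne
  obtain ⟨j, hj⟩ := exists_pullback_one_ne σ hne
  exact hj (by rw [h])

variable [TopologicalSpace K] [DiscreteTopology K]

lemma eventually_pullback_mem_MapSet [Finite K] {ρ : (G → K) → (G → K) → ℝ}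
    (hρ : IsCompatMetric (G → K) ρ) {α : G → (G → K) → G → K}
    (hα : ∀ (s : G) (x : G → K) (t : G), α s x t = x (s⁻¹ * t))
    {d : ℕ → ℕ} {σ : ∀ i, G → Equiv.Perm (Fin (d i))} (hσ : IsSoficApprox G d σ)
    (F : Finset G) {δ : ℝ} (hδ : 0 < δ) :
    ∀ᶠ i in atTop, ∀ ω : Fin (d i) → K, pullback (σ i) ω ∈ MapSet α ρ F δ (σ i) := by
  have key : ∀ s ∈ F, ∀ᶠ i in atTop, ∀ ω : Fin (d i) → K,
      rho2 ρ (fun j => α s (pullback (σ i) ω j)) (fun j => pullback (σ i) ω (σ i s j)) < δ := by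
    intro s _
    obtain ⟨A, hA⟩ := exists_finset_agree_lt hρ.cont hρ.refl (half_pos hδ)
    obtain ⟨C, hC⟩ := (isCompact_univ (X := (G → K) × (G → K))).exists_bound_of_continuousOn
      hρ.cont.continuousOn
    have hC' : ∀ x y, ρ x y ^ 2 ≤ C ^ 2 := fun x y =>
      pow_le_pow_left₀ (hρ.nonneg x y) ((le_abs_self _).trans (hC (x, y) trivial)) 2
    have hbad := tendsto_card_filter_exists_div A
      (fun t i j => ¬ σ i t⁻¹ (σ i s j) = σ i (t⁻¹ * s) j) fun t _ => by
        convert tendsto_card_filter_not_div hσ.dim_top _ (hσ.mul t⁻¹ s)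
    have hlim := hbad.mul_const (C ^ 2)
    rw [zero_mul] at hlim
    filter_upwards [hlim.eventually_lt_const (show (0 : ℝ) < δ ^ 2 / 2 by positivity),
      hσ.dim_top.eventually_gt_atTop 0] with i hi hdi ω
    have hd : (0 : ℝ) < d i := by exact_mod_cast hdi
    set B := Finset.univ.filter fun j => ∃ t ∈ A, ¬ σ i t⁻¹ (σ i s j) = σ i (t⁻¹ * s) j with hB
    refine (Real.sqrt_lt' hδ).2 ?_
    have hterm : ∀ j, ρ (α s (pullback (σ i) ω j)) (pullback (σ i) ω (σ i s j)) ^ 2 ≤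
        (δ / 2) ^ 2 + if j ∈ B then C ^ 2 else 0 := by
      intro j
      by_cases hj : j ∈ B
      · rw [if_pos hj]
        linarith [hC' (α s (pullback (σ i) ω j)) (pullback (σ i) ω (σ i s j)), sq_nonneg (δ / 2)]
      · rw [if_neg hj, add_zero]
        refine pow_le_pow_left₀ (hρ.nonneg _ _) (hA _ _ fun t ht => ?_).le 2
        have : σ i t⁻¹ (σ i s j) = σ i (t⁻¹ * s) j := by
          by_contra h
          exact hj (Finset.mem_filter.2 ⟨Finset.mem_univ _, t, ht, h⟩)
        simp only [hα, pullback, this, mul_inv_rev, inv_inv]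
    have hsum : ∑ j, ρ (α s (pullback (σ i) ω j)) (pullback (σ i) ω (σ i s j)) ^ 2 ≤
        d i * (δ / 2) ^ 2 + B.card * C ^ 2 := by
      refine (Finset.sum_le_sum fun j _ => hterm j).trans_eq ?_
      rw [Finset.sum_add_distrib, Finset.sum_ite_mem, Finset.univ_inter]
      simp
    rw [one_div, inv_mul_lt_iff₀ hd]
    have hi' : B.card * C ^ 2 < d i * (δ ^ 2 / 2) := by
      rw [div_mul_eq_mul_div, div_lt_iff₀ hd] at hi
      linarith
    nlinarith [mul_pos hd (pow_pos hδ 2)]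
  exact (Filter.eventually_all_finset F).2 key |>.mono fun i h ω s hs => h s hs ω

end Pullback

section Bernoulli

open ProbabilityTheory

variable {G K : Type*}

lemma measure_pi_agree [Fintype K] [MeasurableSpace K] [DiscreteMeasurableSpace K]
    (p : Measure K) [IsProbabilityMeasure p] {ι κ : Type*} [Fintype ι] [Fintype κ]
    {e : κ → ι} (he : Function.Injective e) :
    Measure.map (fun (ω : ι → K) t => ω (e t)) (Measure.pi fun _ => p) = Measure.pi fun _ => p := by
  have h1 : iIndepFun (fun i (ω : ι → K) => ω i) (Measure.pi fun _ => p) :=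
    iIndepFun_pi (X := fun _ x => x) fun _ => aemeasurable_id
  have h2 := (iIndepFun_iff_map_fun_eq_pi_map
    fun t => (measurable_pi_apply (e t)).aemeasurable).1 (h1.precomp he)
  rw [h2]
  congr 1
  funext t
  exact (measurePreserving_eval (fun _ : ι => p) (e t)).map_eq

lemma integral_sq_sum_le [Fintype K] [MeasurableSpace K] [DiscreteMeasurableSpace K]
    (p : Measure K) [IsProbabilityMeasure p] {κ : Type*} [Fintype κ] {d : ℕ}
    (e : Fin d → κ → Fin d) (he : ∀ t, Function.Injective fun j => e j t)
    (h : (κ → K) → ℝ) {C : ℝ} (hC : ∀ u, |h u| ≤ C)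
    (hmean : ∫ u, h u ∂(Measure.pi fun _ => p) = 0) :
    ∫ ω : Fin d → K, (∑ j, h fun t => ω (e j t)) ^ 2 ∂(Measure.pi fun _ => p) ≤
      C ^ 2 * (d * (Fintype.card κ ^ 2 +
        (Finset.univ.filter fun j => ¬ Function.Injective (e j)).card)) := by
  set P : Measure (Fin d → K) := Measure.pi fun _ => p
  set B := Finset.univ.filter fun j => ¬ Function.Injective (e j) with hB
  let S : Fin d → Finset (Fin d) := fun j => Finset.univ.image (e j)
  have hindep : iIndepFun (fun i (ω : Fin d → K) => ω i) P :=
    iIndepFun_pi (X := fun _ x => x) fun _ => aemeasurable_id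
  have hzero : ∀ j l, j ∉ B → Disjoint (S j) (S l) →
      ∫ ω, (h fun t => ω (e j t)) * (h fun t => ω (e l t)) ∂P = 0 := by
    intro j l hj hjl
    have hmem : ∀ m t, e m t ∈ S m := fun m t => Finset.mem_image_of_mem _ (Finset.mem_univ t)
    have h1 := (hindep.indepFun_finset (S j) (S l) hjl fun i => measurable_pi_apply i).comp
      (φ := fun u : S j → K => h fun t => u ⟨e j t, hmem j t⟩)
      (ψ := fun u : S l → K => h fun t => u ⟨e l t, hmem l t⟩)
      (measurable_of_countable _) (measurable_of_countable _)
    have h2 := h1.integral_fun_mul_eq_mul_integral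
      (measurable_of_countable _).aestronglyMeasurable
      (measurable_of_countable _).aestronglyMeasurable
    have h3 : ∫ ω, (h fun t => ω (e j t)) ∂P = 0 := by
      have hinj : Function.Injective (e j) := by
        by_contra hn
        exact hj (Finset.mem_filter.2 ⟨Finset.mem_univ _, hn⟩)
      rw [← hmean, ← measure_pi_agree p hinj, integral_map
        (measurable_of_countable _).aemeasurable
        (measurable_of_countable _).aestronglyMeasurable]
    refine h2.trans ?_
    simp only [Function.comp_def, h3, zero_mul]
  have hbound : ∀ j l, ∫ ω, (h fun t => ω (e j t)) * (h fun t => ω (e l t)) ∂P ≤ C ^ 2 := by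
    intro j l
    have : ∀ ω : Fin d → K, (h fun t => ω (e j t)) * (h fun t => ω (e l t)) ≤ C ^ 2 := by
      intro ω
      refine (le_abs_self _).trans ?_
      rw [abs_mul, sq]
      exact mul_le_mul (hC _) (hC _) (abs_nonneg _) ((abs_nonneg _).trans (hC fun t => ω (e j t)))
    calc _ ≤ ∫ _ω, C ^ 2 ∂P := integral_mono .of_finite .of_finite this
      _ = C ^ 2 := by simp
  have hrow : ∀ j, ∑ l, ∫ ω, (h fun t => ω (e j t)) * (h fun t => ω (e l t)) ∂P ≤
      C ^ 2 * Fintype.card κ ^ 2 + if j ∈ B then d * C ^ 2 else 0 := by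
    intro j
    by_cases hj : j ∈ B
    · rw [if_pos hj]
      have h1 := Finset.sum_le_card_nsmul Finset.univ _ (C ^ 2) fun l _ => hbound j l
      simp only [Finset.card_univ, Fintype.card_fin, nsmul_eq_mul] at h1
      have : 0 ≤ C ^ 2 * (Fintype.card κ : ℝ) ^ 2 := by positivity
      linarith
    · rw [if_neg hj, add_zero]
      let M := Finset.univ.filter fun l => ¬ Disjoint (S j) (S l)
      have hM : M.card ≤ Fintype.card κ ^ 2 := by
        let Q : κ × κ → Finset (Fin d) := fun q =>
          Finset.univ.filter fun l => e l q.2 = e j q.1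
        have hsub : M ⊆ Finset.univ.biUnion Q := by
          intro l hl
          obtain ⟨x, hx, hx'⟩ := Finset.not_disjoint_iff.1 (Finset.mem_filter.1 hl).2
          obtain ⟨t, -, rfl⟩ := Finset.mem_image.1 hx
          obtain ⟨t', -, ht'⟩ := Finset.mem_image.1 hx'
          simp only [Q, Finset.mem_biUnion, Finset.mem_univ, true_and, Finset.mem_filter]
          exact ⟨(t, t'), ht'⟩
        have hQ : ∀ q ∈ (Finset.univ : Finset (κ × κ)), (Q q).card ≤ 1 := by
          intro q _
          refine Finset.card_le_one.2 fun l hl l' hl' => he q.2 ?_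
          exact (Finset.mem_filter.1 hl).2.trans (Finset.mem_filter.1 hl').2.symm
        refine (Finset.card_le_card hsub).trans ((Finset.card_biUnion_le_card_mul _ _ 1 hQ).trans ?_)
        simp [sq]
      calc _ ≤ ∑ l, if l ∈ M then C ^ 2 else 0 := by
            refine Finset.sum_le_sum fun l _ => ?_
            by_cases hl : l ∈ M
            · rw [if_pos hl]; exact hbound j l
            · rw [if_neg hl]
              refine (hzero j l hj ?_).le
              by_contra hn
              exact hl (Finset.mem_filter.2 ⟨Finset.mem_univ _, hn⟩)
        _ = M.card * C ^ 2 := by simp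
        _ ≤ _ := by
            rw [mul_comm]
            gcongr
            exact_mod_cast hM
  calc _ = ∑ j, ∑ l, ∫ ω, (h fun t => ω (e j t)) * (h fun t => ω (e l t)) ∂P := by
        simp only [sq, Finset.sum_mul_sum]
        rw [integral_finsetSum _ fun _ _ => .of_finite]
        exact Finset.sum_congr rfl fun j _ => integral_finsetSum _ fun _ _ => .of_finite
    _ ≤ ∑ j, (C ^ 2 * Fintype.card κ ^ 2 + if j ∈ B then d * C ^ 2 else 0) :=
        Finset.sum_le_sum fun j _ => hrow j
    _ = _ := by
        rw [Finset.sum_add_distrib, Finset.sum_ite_mem, Finset.univ_inter]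
        simp only [Finset.sum_const, Finset.card_univ, Fintype.card_fin, nsmul_eq_mul]
        ring


lemma isPiSystem_cylinder :
    IsPiSystem {S : Set (G → K) | ∃ (F : Finset G) (c : G → K), S = {x | ∀ s ∈ F, x s = c s}} := by
  rintro _ ⟨F, c, rfl⟩ _ ⟨F', c', rfl⟩ ⟨x₀, h, h'⟩
  refine ⟨F ∪ F', x₀, ?_⟩
  ext x
  simp only [Set.mem_inter_iff, Set.mem_ofPred_eq, Finset.mem_union] at h h' ⊢
  constructor
  · rintro ⟨hx, hx'⟩ s (hs | hs)
    · rw [hx s hs, h s hs]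
    · rw [hx' s hs, h' s hs]
  · intro hx
    exact ⟨fun s hs => (hx s (.inl hs)).trans (h s hs), fun s hs => (hx s (.inr hs)).trans (h' s hs)⟩

variable [TopologicalSpace K] [DiscreteTopology K]

lemma isClosed_cylinder (F : Finset G) (c : G → K) : IsClosed {x : G → K | ∀ s ∈ F, x s = c s} := by
  simp only [Set.ofPred_forall]
  exact isClosed_biInter fun s _ => isClosed_eq (continuous_apply s) continuous_const

lemma borel_eq_generateFrom_cylinder [Countable G] [Countable K] :
    borel (G → K) = MeasurableSpace.generateFrom
      {S : Set (G → K) | ∃ (F : Finset G) (c : G → K), S = {x | ∀ s ∈ F, x s = c s}} := by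
  let : MeasurableSpace K := ⊤
  have : BorelSpace K := inferInstance
  refine le_antisymm ?_ (MeasurableSpace.generateFrom_le ?_)
  · rw [← (Pi.borelSpace : BorelSpace (G → K)).measurable_eq]
    refine iSup_le fun t => ?_
    rw [← measurable_iff_comap_le]
    refine @measurable_to_countable' _ _ _ _ (_) _ fun c => ?_
    refine MeasurableSpace.measurableSet_generateFrom ⟨{t}, fun _ => c, ?_⟩
    ext x
    simp
  · rintro _ ⟨F, c, rfl⟩
    exact @MeasurableSet.of_compl _ _ (borel _)
      (MeasurableSpace.measurableSet_generateFrom (isClosed_cylinder F c).isOpen_compl)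

variable [MeasurableSpace (G → K)] [BorelSpace (G → K)]

lemma isInvProb_of_cylinder [Group G] [Countable G] [Countable K] [Nonempty K]
    {α : G → (G → K) → G → K} (hα : ∀ (s : G) (x : G → K) (t : G), α s x t = x (s⁻¹ * t))
    {ν : Measure (G → K)} {q : K → ENNReal}
    (hν : ∀ (F : Finset G) (c : G → K), ν {x | ∀ s ∈ F, x s = c s} = ∏ s ∈ F, q (c s)) :
    IsInvProb α ν := by
  have hprob : IsProbabilityMeasure ν := ⟨by
    simpa using hν ∅ fun _ => Classical.arbitrary K⟩
  refine ⟨hprob, fun s => ?_⟩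
  have hmeas : Measurable (α s) := by
    refine Continuous.measurable (continuous_pi fun t => ?_)
    simp only [hα]
    exact continuous_apply _
  have := Measure.isProbabilityMeasure_map (μ := ν) hmeas.aemeasurable
  refine ext_of_generate_finite _
    ((BorelSpace.measurable_eq (α := G → K)).trans borel_eq_generateFrom_cylinder)
    isPiSystem_cylinder ?_ (by simp)
  rintro _ ⟨F, c, rfl⟩
  rw [Measure.map_apply hmeas (isClosed_cylinder F c).measurableSet, hν]
  have hpre : α s ⁻¹' {x | ∀ t ∈ F, x t = c t} =
      {x | ∀ t ∈ F.image (s⁻¹ * ·), x t = c (s * t)} := by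
    ext x
    simp only [Set.mem_preimage, Set.mem_ofPred_eq, Finset.forall_mem_image, hα,
      mul_inv_cancel_left]
  rw [hpre, hν, Finset.prod_image fun _ _ _ _ h => mul_left_cancel h]
  simp

variable [Fintype K] [mK : MeasurableSpace K] [DiscreteMeasurableSpace K]

lemma measurable_restrict_finset (A : Finset G) : Measurable fun (x : G → K) (t : A) => x t := by
  have : BorelSpace K := inferInstance
  exact (continuous_pi fun t : A => continuous_apply (t : G)).measurable

lemma map_restrict_eq_pi [Nonempty K] {ν : Measure (G → K)} (p : Measure K)
    [IsProbabilityMeasure p]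
    (hν : ∀ (F : Finset G) (c : G → K), ν {x | ∀ s ∈ F, x s = c s} = ∏ s ∈ F, p {c s})
    (A : Finset G) :
    Measure.map (fun (x : G → K) (t : A) => x t) ν = Measure.pi fun _ => p := by
  refine Measure.ext_iff_singleton.2 fun u => ?_
  rw [Measure.map_apply (measurable_restrict_finset A) (measurableSet_singleton u),
    Measure.pi_singleton]
  let c : G → K := fun t => if h : t ∈ A then u ⟨t, h⟩ else Classical.arbitrary K
  have hc : ∀ t : A, c t = u t := fun t => by simp [c]
  have hpre : (fun (x : G → K) (t : A) => x t) ⁻¹' {u} = {x | ∀ t ∈ A, x t = c t} := by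
    ext x
    simp only [Set.mem_preimage, Set.mem_singleton_iff, funext_iff, Set.mem_ofPred_eq]
    exact ⟨fun h t ht => (h ⟨t, ht⟩).trans (hc ⟨t, ht⟩).symm,
      fun h t => (h t t.2).trans (hc t)⟩
  rw [hpre, hν, ← Finset.prod_coe_sort]
  simp only [hc]

lemma tendsto_measure_empirical [Nonempty K] [Group G] {d : ℕ → ℕ}
    {σ : ∀ i, G → Equiv.Perm (Fin (d i))} (hσ : IsSoficApprox G d σ)
    {ν : Measure (G → K)} [IsProbabilityMeasure ν] (p : Measure K) [IsProbabilityMeasure p]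
    (hν : ∀ (F : Finset G) (c : G → K), ν {x | ∀ s ∈ F, x s = c s} = ∏ s ∈ F, p {c s})
    (g : C(G → K, ℝ)) {δ : ℝ} (hδ : 0 < δ) :
    Tendsto (fun i => (Measure.pi fun _ : Fin (d i) => p).real
      {ω | δ ≤ |(1 / (d i : ℝ)) * ∑ j, g (pullback (σ i) ω j) - ∫ x, g x ∂ν|}) atTop (nhds 0) := by
  obtain ⟨A, hA⟩ := exists_finset_agree_lt (D := fun x y => |g x - g y|)
    (by fun_prop) (by simp) (show 0 < δ / 4 by positivity)
  let ext : (A → K) → G → K := fun u t =>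
    if h : t ∈ A then u ⟨t, h⟩ else Classical.arbitrary K
  have hext : ∀ x : G → K, |g x - g (ext fun t => x t)| < δ / 4 := by
    refine fun x => hA _ _ fun t ht => ?_
    simp [ext, ht]
  set m : ℝ := ∫ u, g (ext u) ∂(Measure.pi fun _ => p) with hm
  have hint : |∫ x, g x ∂ν - m| ≤ δ / 4 := by
    have h1 : m = ∫ x, g (ext fun t => x t) ∂ν := by
      rw [hm, ← map_restrict_eq_pi p hν A, integral_map
        (measurable_restrict_finset A).aemeasurable
        (measurable_of_countable _).aestronglyMeasurable]
    have hgi : Integrable g ν := by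
      obtain ⟨C, hC⟩ := (isCompact_univ (X := G → K)).exists_bound_of_continuousOn
        g.continuous.continuousOn
      exact .of_bound g.continuous.measurable.aestronglyMeasurable C (.of_forall fun x => hC x trivial)
    have hei : Integrable (fun x : G → K => g (ext fun t => x t)) ν := by
      have : Integrable (fun u => g (ext u)) (Measure.map (fun (x : G → K) (t : A) => x t) ν) := by
        rw [map_restrict_eq_pi p hν A]
        exact .of_finite
      exact this.comp_measurable (measurable_restrict_finset A)
    rw [h1, ← integral_sub hgi hei, ← Real.norm_eq_abs]
    refine (norm_integral_le_of_norm_le_const (μ := ν)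
      (Filter.Eventually.of_forall fun x => (hext x).le)).trans_eq ?_
    rw [probReal_univ, mul_one]
  obtain ⟨C, hC⟩ : ∃ C, ∀ u, |g (ext u) - m| ≤ C := by
    obtain ⟨C, hC⟩ := (Set.finite_range fun u => |g (ext u) - m|).bddAbove
    exact ⟨C, fun u => hC ⟨u, rfl⟩⟩
  let e : ∀ i, Fin (d i) → A → Fin (d i) := fun i j t => σ i (t : G)⁻¹ j
  have hbad : Tendsto (fun i => ((Finset.univ.filter fun j =>
      ¬ Function.Injective (e i j)).card : ℝ) / (d i : ℝ)) atTop (nhds 0) := by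
    have h1 := tendsto_card_filter_exists_div
      (Finset.univ.filter fun q : A × A => q.1 ≠ q.2)
      (fun q i j => ¬ σ i (q.1 : G)⁻¹ j ≠ σ i (q.2 : G)⁻¹ j) fun q hq => by
        refine tendsto_card_filter_not_div hσ.dim_top _ (hσ.sep _ _ fun h => ?_)
        exact (Finset.mem_filter.1 hq).2 (Subtype.ext (inv_injective h))
    refine h1.congr fun i => ?_
    congr 3
    ext j
    simp only [Function.Injective, e, not_forall, Finset.mem_filter, Finset.mem_univ, true_and,
      not_not, Prod.exists, exists_prop, ne_eq]
    constructor
    · rintro ⟨t, t', hne, h⟩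
      exact ⟨t, t', h, hne⟩
    · rintro ⟨t, t', h, hne⟩
      exact ⟨t, t', hne, h⟩
  have hdinv : Tendsto (fun i => (Fintype.card A : ℝ) ^ 2 / (d i : ℝ)) atTop (nhds 0) :=
    (tendsto_natCast_atTop_atTop.comp hσ.dim_top).const_div_atTop _
  have hlim := ((hdinv.add hbad).const_mul (C ^ 2)).div_const ((δ / 2) ^ 2)
  simp only [add_zero, mul_zero, zero_div] at hlim
  refine squeeze_zero' (.of_forall fun i => measureReal_nonneg) ?_ hlim
  filter_upwards [hσ.dim_top.eventually_gt_atTop 0] with i hi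
  have hd : (0 : ℝ) < d i := by exact_mod_cast hi
  set P : Measure (Fin (d i) → K) := Measure.pi fun _ => p
  let Y : (Fin (d i) → K) → ℝ := fun ω => ∑ j, (g (ext fun t => ω (e i j t)) - m)
  have hsub : {ω | δ ≤ |(1 / (d i : ℝ)) * ∑ j, g (pullback (σ i) ω j) - ∫ x, g x ∂ν|} ⊆
      {ω | (d i * (δ / 2)) ^ 2 ≤ Y ω ^ 2} := by
    intro ω hω
    rw [Set.mem_ofPred_eq] at hω ⊢
    refine sq_le_sq' ?_ ?_ |>.trans_eq (sq_abs _)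
    · have : 0 ≤ d i * (δ / 2) := by positivity
      linarith [abs_nonneg (Y ω)]
    have h1 : |∑ j, g (pullback (σ i) ω j) - ∑ j, g (ext fun t => ω (e i j t))| ≤
        d i * (δ / 4) := by
      rw [← Finset.sum_sub_distrib]
      refine (Finset.abs_sum_le_sum_abs _ _).trans ?_
      refine (Finset.sum_le_sum fun j _ => (hext (pullback (σ i) ω j)).le).trans_eq ?_
      simp
    have h2 : Y ω = ∑ j, g (ext fun t => ω (e i j t)) - d i * m := by
      simp [Y, Finset.sum_sub_distrib]
    have h3 : d i * δ ≤ |∑ j, g (pullback (σ i) ω j) - d i * ∫ x, g x ∂ν| := by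
      calc d i * δ ≤ d i * |(1 / (d i : ℝ)) * ∑ j, g (pullback (σ i) ω j) - ∫ x, g x ∂ν| := by
            gcongr
        _ = |d i * ((1 / (d i : ℝ)) * ∑ j, g (pullback (σ i) ω j) - ∫ x, g x ∂ν)| := by
            rw [abs_mul, abs_of_pos hd]
        _ = _ := by
            congr 1
            field_simp
    have h4 : |d i * ∫ x, g x ∂ν - d i * m| ≤ d i * (δ / 4) := by
      rw [← mul_sub, abs_mul, abs_of_pos hd]
      gcongr
    rw [h2]
    rw [abs_le] at h1 h4
    rcases le_abs.1 h3 with h | h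
    · exact le_abs.2 (.inl (by linarith [h1.2, h4.1]))
    · exact le_abs.2 (.inr (by linarith [h1.1, h4.2]))
  have hmom := integral_sq_sum_le p (e i)
    (fun t => (σ i (t : G)⁻¹).injective) (fun u => g (ext u) - m) hC (by
      rw [integral_sub .of_finite .of_finite]
      simp [hm])
  have hmarkov := mul_meas_ge_le_integral_of_nonneg (μ := P) (f := fun ω => Y ω ^ 2)
    (.of_forall fun ω => sq_nonneg _) .of_finite ((d i * (δ / 2)) ^ 2)
  have hmono := measureReal_mono (μ := P) hsub
  refine hmono.trans ?_
  rw [le_div_iff₀ (by positivity)]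
  have h5 := hmarkov.trans hmom
  refine le_of_mul_le_mul_left ?_ (pow_pos hd 2)
  calc _ = (d i * (δ / 2)) ^ 2 * P.real {ω | (d i * (δ / 2)) ^ 2 ≤ Y ω ^ 2} := by ring
    _ ≤ _ := h5
    _ = _ := by field_simp

lemma eventually_exists_separated_card [Nonempty K] [Group G]
    {ρ : (G → K) → (G → K) → ℝ} (hρ : IsCompatMetric (G → K) ρ) {α : G → (G → K) → G → K}
    (hα : ∀ (s : G) (x : G → K) (t : G), α s x t = x (s⁻¹ * t))
    {d : ℕ → ℕ} {σ : ∀ i, G → Equiv.Perm (Fin (d i))} (hσ : IsSoficApprox G d σ)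
    {ν : Measure (G → K)} [IsProbabilityMeasure ν] (p : Measure K) [IsProbabilityMeasure p]
    (hν : ∀ (F : Finset G) (c : G → K), ν {x | ∀ s ∈ F, x s = c s} = ∏ s ∈ F, p {c s})
    {b : K → ℝ} (hp : ∀ c, p.real {c} = Real.exp (b c) / ∑ c', Real.exp (b c'))
    {f : C(G → K, ℝ)} (hf : ∀ x, f x = b (x 1))
    {ε : ℝ} (hε : ∀ x y : G → K, x 1 ≠ y 1 → ε ≤ ρ x y)
    (F : Finset G) (L : Finset C(G → K, ℝ)) {δ κ : ℝ} (hδ : 0 < δ) (hκ : 0 < κ) :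
    ∀ᶠ i in atTop, ∃ E : Finset (Fin (d i) → G → K), ↑E ⊆ MapMuSet α ν ρ F L δ (σ i) ∧
      (∀ φ ∈ E, ∀ ψ ∈ E, φ ≠ ψ → ε ≤ rhoInf ρ φ ψ) ∧
      Real.exp (d i * (Real.log (∑ c, Real.exp (b c)) - ∫ x, f x ∂ν - κ)) ≤ E.card := by
  set Z : ℝ := ∑ c, Real.exp (b c) with hZ
  have hZpos : 0 < Z := Finset.sum_pos (fun _ _ => Real.exp_pos _) Finset.univ_nonempty
  set η : ℝ := min δ (κ / 2) with hη
  have hηpos : 0 < η := lt_min hδ (half_pos hκ)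
  have hlim := tendsto_finsetSum (insert f L) fun g _ =>
    tendsto_measure_empirical hσ p hν g hηpos
  rw [Finset.sum_const_zero] at hlim
  have hdκ : ∀ᶠ i in atTop, 1 ≤ (d i : ℝ) * (κ / 2) :=
    ((tendsto_natCast_atTop_atTop.comp hσ.dim_top).atTop_mul_const
      (half_pos hκ)).eventually_ge_atTop 1
  filter_upwards [hlim.eventually_le_const (show (0 : ℝ) < 1 / 2 by norm_num), hdκ,
    hσ.dim_top.eventually_gt_atTop 0, eventually_pullback_mem_MapSet hρ hα hσ F hδ]
    with i hi hdκi hdi hmap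
  have hd : (0 : ℝ) < d i := by exact_mod_cast hdi
  set P : Measure (Fin (d i) → K) := Measure.pi fun _ => p with hP
  set good : Finset (Fin (d i) → K) := Finset.univ.filter fun ω => ∀ g ∈ insert f L,
    |(1 / (d i : ℝ)) * ∑ j, g (pullback (σ i) ω j) - ∫ x, g x ∂ν| < η with hgood
  have hhalf : 1 / 2 ≤ P.real (good : Set (Fin (d i) → K)) := by
    have hcompl : (good : Set (Fin (d i) → K))ᶜ ⊆ ⋃ g ∈ insert f L,
        {ω | η ≤ |(1 / (d i : ℝ)) * ∑ j, g (pullback (σ i) ω j) - ∫ x, g x ∂ν|} := by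
      intro ω hω
      simp only [hgood, Set.mem_compl_iff, Finset.mem_coe, Finset.mem_filter, Finset.mem_univ,
        true_and, not_forall, not_lt] at hω
      obtain ⟨g, hg, h⟩ := hω
      exact Set.mem_biUnion (x := g) hg h
    have h1 := (measureReal_mono (μ := P) hcompl (measure_ne_top P _)).trans (measureReal_biUnion_finset_le _ _)
    rw [measureReal_compl good.measurableSet, probReal_univ] at h1
    linarith
  have hpoint : ∀ ω ∈ good, P.real {ω} ≤
      Real.exp (d i * (∫ x, f x ∂ν + κ / 2 - Real.log Z)) := by
    intro ω hω
    have h1 : P.real {ω} = Real.exp (∑ j, b (ω j) - d i * Real.log Z) := by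
      have h2 : P.real {ω} = ∏ j, p.real {ω j} := by
        simp only [measureReal_def, hP, Measure.pi_singleton, ENNReal.toReal_prod]
      rw [h2, Real.exp_sub, Real.exp_sum, Real.exp_nat_mul, Real.exp_log hZpos]
      simp [hp, Finset.prod_div_distrib]
    rw [h1]
    refine Real.exp_le_exp.2 ?_
    have h3 := (Finset.mem_filter.1 hω).2 f (Finset.mem_insert_self _ _)
    simp only [hf] at h3
    rw [sum_pullback_one] at h3
    simp only [← hf] at h3
    have h4 : 1 / (d i : ℝ) * ∑ j, b (ω j) ≤ ∫ x, f x ∂ν + κ / 2 := by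
      linarith [(abs_lt.1 h3).2, min_le_right δ (κ / 2)]
    rw [one_div, inv_mul_le_iff₀ hd] at h4
    linarith
  have hcard : 1 / 2 ≤ good.card * Real.exp (d i * (∫ x, f x ∂ν + κ / 2 - Real.log Z)) := by
    rw [← sum_measureReal_singleton] at hhalf
    refine hhalf.trans ((Finset.sum_le_card_nsmul _ _ _ hpoint).trans_eq ?_)
    rw [nsmul_eq_mul]
  refine ⟨good.image (pullback (σ i)), ?_, ?_, ?_⟩
  · intro φ hφ
    obtain ⟨ω, hω, rfl⟩ := Finset.mem_image.1 hφ
    refine ⟨hmap ω, fun g hg => ?_⟩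
    exact ((Finset.mem_filter.1 hω).2 g (Finset.mem_insert_of_mem hg)).trans_le (min_le_left _ _)
  · intro φ hφ ψ hψ hne
    obtain ⟨ω, -, rfl⟩ := Finset.mem_image.1 hφ
    obtain ⟨ω', -, rfl⟩ := Finset.mem_image.1 hψ
    obtain ⟨j, hj⟩ := exists_pullback_one_ne (σ i) fun h => hne (congrArg _ h)
    exact le_rhoInf j (hε _ _ hj)
  · rw [Finset.card_image_of_injective _ (pullback_injective (σ i))]
    have h5 : 2 ≤ Real.exp (d i * (κ / 2)) := by linarith [Real.add_one_le_exp (d i * (κ / 2))]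
    have h6 : Real.exp (d i * (Real.log Z - ∫ x, f x ∂ν - κ)) *
        Real.exp (d i * (∫ x, f x ∂ν + κ / 2 - Real.log Z)) * Real.exp (d i * (κ / 2)) = 1 := by
      rw [← Real.exp_add, ← Real.exp_add, ← Real.exp_zero]
      congr 1
      ring
    refine le_of_mul_le_mul_right ?_ (Real.exp_pos (d i * (∫ x, f x ∂ν + κ / 2 - Real.log Z)))
    refine le_trans ?_ hcard
    have h7 := mul_pos (Real.exp_pos (d i * (Real.log Z - ∫ x, f x ∂ν - κ)))
      (Real.exp_pos (d i * (∫ x, f x ∂ν + κ / 2 - Real.log Z)))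
    nlinarith

lemma measEntropy_ge [Nonempty K] [Group G]
    {ρ : (G → K) → (G → K) → ℝ} (hρ : IsCompatMetric (G → K) ρ) {α : G → (G → K) → G → K}
    (hα : ∀ (s : G) (x : G → K) (t : G), α s x t = x (s⁻¹ * t))
    {d : ℕ → ℕ} {σ : ∀ i, G → Equiv.Perm (Fin (d i))} (hσ : IsSoficApprox G d σ)
    {ν : Measure (G → K)} [IsProbabilityMeasure ν] (p : Measure K) [IsProbabilityMeasure p]
    (hν : ∀ (F : Finset G) (c : G → K), ν {x | ∀ s ∈ F, x s = c s} = ∏ s ∈ F, p {c s})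
    {b : K → ℝ} (hp : ∀ c, p.real {c} = Real.exp (b c) / ∑ c', Real.exp (b c'))
    {f : C(G → K, ℝ)} (hf : ∀ x, f x = b (x 1)) :
    ((Real.log (∑ c, Real.exp (b c)) - ∫ x, f x ∂ν : ℝ) : EReal) ≤ MeasEntropy α ν ρ d σ := by
  obtain ⟨ε, hε, hsep⟩ := exists_pos_le_of_ne hρ (1 : G)
  refine le_iSup₂_of_le ε hε (le_iInf₂ fun F _ => le_iInf₂ fun L _ => le_iInf₂ fun δ hδ => ?_)
  refine EReal.ge_of_forall_gt_iff_ge.1 fun z hz => ?_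
  have hκ := sub_pos.2 (EReal.coe_lt_coe_iff.1 hz)
  refine le_limsup_of_frequently_le (Eventually.frequently ?_)
  filter_upwards [eventually_exists_separated_card hρ hα hσ p hν hp hf hsep F L hδ hκ,
    hσ.dim_top.eventually_gt_atTop 0] with i hi hdi
  have hd : (0 : ℝ) < d i := by exact_mod_cast hdi
  obtain ⟨E, hE, hEsep, hcard⟩ := hi
  rw [sub_sub_cancel] at hcard
  have hpos := (Real.exp_pos _).trans_le hcard
  obtain ⟨φ, hφ⟩ : E.Nonempty := by
    rw [← Finset.card_pos]
    exact_mod_cast hpos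
  rw [if_pos ⟨φ, hE hφ⟩, EReal.coe_le_coe_iff, le_div_iff₀ hd, mul_comm]
  refine (Real.le_log_iff_exp_le (hpos.trans_le ?_)).2 (hcard.trans ?_) <;>
  exact le_csSup (bddAbove_Nval hρ hε _) ⟨E, hE, hEsep, rfl⟩

end Bernoulli

section Values

variable {G K : Type*} [Group G] [Fintype K] [Nonempty K] [TopologicalSpace K] [DiscreteTopology K]

lemma pressureInf_le {ρ : (G → K) → (G → K) → ℝ} (hρ : IsCompatMetric (G → K) ρ)
    {α : G → (G → K) → G → K} (hα : ∀ (s : G) (x : G → K) (t : G), α s x t = x (s⁻¹ * t))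
    {d : ℕ → ℕ} {σ : ∀ i, G → Equiv.Perm (Fin (d i))} (hd : Tendsto d atTop atTop)
    {b : K → ℝ} {f : (G → K) → ℝ} (hf : ∀ x, f x = b (x 1)) :
    PressureInf α f ρ d σ ≤ ((Real.log (∑ c, Real.exp (b c)) : ℝ) : EReal) := by
  refine iSup₂_le fun ε hε => EReal.le_of_forall_lt_iff_le.1 fun z hz => ?_
  have hκ := sub_pos.2 (EReal.coe_lt_coe_iff.1 hz)
  obtain ⟨C, hC⟩ : ∃ C, ∀ x, f x ≤ C := by
    obtain ⟨C, hC⟩ := (Set.finite_range b).bddAbove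
    exact ⟨C, fun x => hf x ▸ hC ⟨x 1, rfl⟩⟩
  obtain ⟨F, hF, δ, hδ, hsum⟩ := exists_sum_exp_le hρ hα b hε hκ
  refine iInf₂_le_of_le F hF (iInf₂_le_of_le δ hδ (limsup_le_of_le (h := ?_)))
  filter_upwards [hd.eventually_gt_atTop 0] with i hdi
  have hd : (0 : ℝ) < d i := by exact_mod_cast hdi
  split_ifs with hne
  swap
  · exact bot_le
  rw [EReal.coe_le_coe_iff, div_le_iff₀ hd]
  have hpos : 0 < Mval α f ρ ε F δ (σ i) (rhoInf ρ) := by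
    obtain ⟨φ, hφ⟩ := hne
    refine (Real.exp_pos (∑ j, f (φ j))).trans_le
      (le_csSup (bddAbove_Mval hρ hε α F δ (σ i) hC) ⟨{φ}, by simpa using hφ, ?_, by simp⟩)
    intro φ₁ h₁ φ₂ h₂ h
    exact (h ((Finset.mem_singleton.1 h₁).trans (Finset.mem_singleton.1 h₂).symm)).elim
  refine (Real.log_le_iff_le_exp hpos).2 (csSup_le ⟨0, ∅, by simp⟩ ?_)
  rintro _ ⟨E, hE, hEsep, rfl⟩
  simp only [hf]
  refine (hsum (d i) (σ i) E hE hEsep).trans_eq ?_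
  congr 1
  ring

lemma pressureInf_ge {ρ : (G → K) → (G → K) → ℝ} (hρ : IsCompatMetric (G → K) ρ)
    {α : G → (G → K) → G → K} (hα : ∀ (s : G) (x : G → K) (t : G), α s x t = x (s⁻¹ * t))
    {d : ℕ → ℕ} {σ : ∀ i, G → Equiv.Perm (Fin (d i))} (hσ : IsSoficApprox G d σ)
    {b : K → ℝ} {f : (G → K) → ℝ} (hf : ∀ x, f x = b (x 1)) :
    ((Real.log (∑ c, Real.exp (b c)) : ℝ) : EReal) ≤ PressureInf α f ρ d σ := by
  obtain ⟨ε, hε, hsep⟩ := exists_pos_le_of_ne hρ (1 : G)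
  obtain ⟨C, hC⟩ : ∃ C, ∀ x, f x ≤ C := by
    obtain ⟨C, hC⟩ := (Set.finite_range b).bddAbove
    exact ⟨C, fun x => hf x ▸ hC ⟨x 1, rfl⟩⟩
  refine le_iSup₂_of_le ε hε (le_iInf₂ fun F _ => le_iInf₂ fun δ hδ => ?_)
  refine le_limsup_of_frequently_le (Eventually.frequently ?_)
  filter_upwards [eventually_pullback_mem_MapSet hρ hα hσ F hδ,
    hσ.dim_top.eventually_gt_atTop 0] with i hmap hdi
  have hd : (0 : ℝ) < d i := by exact_mod_cast hdi
  have hZpos : 0 < ∑ c, Real.exp (b c) :=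
    Finset.sum_pos (fun _ _ => Real.exp_pos _) Finset.univ_nonempty
  rw [if_pos ⟨_, hmap fun _ => Classical.arbitrary K⟩, EReal.coe_le_coe_iff, le_div_iff₀ hd,
    mul_comm, ← Real.log_pow]
  refine Real.log_le_log (by positivity) (le_csSup (bddAbove_Mval hρ hε α F δ (σ i) hC)
    ⟨Finset.univ.image (pullback (σ i)), ?_, ?_, ?_⟩)
  · intro φ hφ
    obtain ⟨ω, -, rfl⟩ := Finset.mem_image.1 hφ
    exact hmap ω
  · intro φ hφ ψ hψ hne
    obtain ⟨ω, -, rfl⟩ := Finset.mem_image.1 hφ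
    obtain ⟨ω', -, rfl⟩ := Finset.mem_image.1 hψ
    obtain ⟨j, hj⟩ := exists_pullback_one_ne (σ i) fun h => hne (congrArg _ h)
    exact le_rhoInf j (hsep _ _ hj)
  · rw [Finset.sum_image (pullback_injective (σ i)).injOn, Fintype.sum_pow]
    simp only [hf, sum_pullback_one, Real.exp_sum]

lemma measEntropy_le [MeasurableSpace (G → K)]
    {ρ : (G → K) → (G → K) → ℝ} (hρ : IsCompatMetric (G → K) ρ) {α : G → (G → K) → G → K}
    (hα : ∀ (s : G) (x : G → K) (t : G), α s x t = x (s⁻¹ * t))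
    {d : ℕ → ℕ} {σ : ∀ i, G → Equiv.Perm (Fin (d i))} (hd : Tendsto d atTop atTop)
    (ν : Measure (G → K)) {b : K → ℝ} {f : C(G → K, ℝ)} (hf : ∀ x, f x = b (x 1)) :
    MeasEntropy α ν ρ d σ ≤ ((Real.log (∑ c, Real.exp (b c)) - ∫ x, f x ∂ν : ℝ) : EReal) := by
  refine iSup₂_le fun ε hε => EReal.le_of_forall_lt_iff_le.1 fun z hz => ?_
  have hκ := half_pos (sub_pos.2 (EReal.coe_lt_coe_iff.1 hz))
  set κ := (z - (Real.log (∑ c, Real.exp (b c)) - ∫ x, f x ∂ν)) / 2 with hκz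
  obtain ⟨F, hF, δ, hδ, hsum⟩ := exists_sum_exp_le hρ hα b hε hκ
  refine iInf₂_le_of_le F hF (iInf₂_le_of_le {f} (Finset.singleton_nonempty f)
    (iInf₂_le_of_le (min δ κ) (lt_min hδ hκ) ?_))
  refine limsup_le_of_le (h := ?_)
  filter_upwards [hd.eventually_gt_atTop 0] with i hdi
  have hd : (0 : ℝ) < d i := by exact_mod_cast hdi
  split_ifs with hne
  swap
  · exact bot_le
  rw [EReal.coe_le_coe_iff, div_le_iff₀ hd]
  have hpos : 0 < Nval ε (MapMuSet α ν ρ F {f} (min δ κ) (σ i)) (rhoInf ρ) := by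
    obtain ⟨φ, hφ⟩ := hne
    refine lt_of_lt_of_le one_pos (le_csSup (bddAbove_Nval hρ hε _)
      ⟨{φ}, by simpa using hφ, ?_, by simp⟩)
    intro φ₁ h₁ φ₂ h₂ h
    exact (h ((Finset.mem_singleton.1 h₁).trans (Finset.mem_singleton.1 h₂).symm)).elim
  refine (Real.log_le_iff_le_exp hpos).2 (csSup_le ⟨0, ∅, by simp⟩ ?_)
  rintro _ ⟨E, hE, hEsep, rfl⟩
  have h1 := hsum (d i) (σ i) E
    (fun φ hφ s hs => ((hE hφ).1 s hs).trans_le (min_le_left _ _)) hEsep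
  have h2 : ∀ φ ∈ E, Real.exp (d i * (∫ x, f x ∂ν - κ)) ≤ Real.exp (∑ j, b (φ j 1)) := by
    intro φ hφ
    refine Real.exp_le_exp.2 ?_
    have h3 := (abs_lt.1 ((hE hφ).2 f (Finset.mem_singleton_self f))).1
    have h4 : ∫ x, f x ∂ν - κ ≤ 1 / (d i : ℝ) * ∑ j, f (φ j) := by
      linarith [min_le_right δ κ]
    rw [one_div, le_inv_mul_iff₀ hd] at h4
    simpa only [hf] using h4
  have h5 := Finset.card_nsmul_le_sum _ _ _ h2
  rw [nsmul_eq_mul] at h5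
  refine le_of_mul_le_mul_right (h5.trans (h1.trans_eq ?_)) (Real.exp_pos _)
  rw [← Real.exp_add, hκz]
  congr 1
  ring

end Values

theorem stmt11 {G : Type*} [Group G] [Countable G]
    (d : ℕ → ℕ) (σ : ∀ i, G → Equiv.Perm (Fin (d i))) (hσ : IsSoficApprox G d σ)
    (k : ℕ) (hk : 0 < k) [TopologicalSpace (Fin k)] [DiscreteTopology (Fin k)]
    [MeasurableSpace (G → Fin k)] [BorelSpace (G → Fin k)]
    (a : Fin k → ℝ)
    (α : G → (G → Fin k) → G → Fin k)
    (hα : ∀ (s : G) (x : G → Fin k) (t : G), α s x t = x (s⁻¹ * t))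
    (f : (G → Fin k) → ℝ) (hfdef : ∀ x, f x = a (x 1))
    (ρ : (G → Fin k) → (G → Fin k) → ℝ) (hρ : IsCompatMetric (G → Fin k) ρ)
    (ν : Measure (G → Fin k))
    (hν : ∀ (F : Finset G) (c : G → Fin k),
      ν {x | ∀ s ∈ F, x s = c s} =
        ∏ s ∈ F, ENNReal.ofReal (Real.exp (a (c s)) / ∑ j, Real.exp (a j))) :
    IsInvProb α ν ∧
    MeasEntropy α ν ρ d σ + (((∫ x, f x ∂ν) : ℝ) : EReal) = PressureInf α f ρ d σ ∧
    PressureInf α f ρ d σ = ((Real.log (∑ j, Real.exp (a j)) : ℝ) : EReal) := by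
  have : Nonempty (Fin k) := ⟨⟨0, hk⟩⟩
  have hinv : IsInvProb α ν := isInvProb_of_cylinder hα
    (q := fun c => ENNReal.ofReal (Real.exp (a c) / ∑ j, Real.exp (a j))) hν
  have hprob := hinv.1
  let fC : C(G → Fin k, ℝ) := ⟨f, by
    simp only [funext hfdef]
    exact continuous_of_discreteTopology.comp (continuous_apply 1)⟩
  have heval : Measurable fun x : G → Fin k => x 1 :=
    measurable_to_countable' fun c => by
      convert (isClosed_cylinder {(1 : G)} fun _ => c).measurableSet using 1
      ext x
      simp
  let p : Measure (Fin k) := ν.map fun x => x 1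
  have hpprob : IsProbabilityMeasure p := Measure.isProbabilityMeasure_map heval.aemeasurable
  have hp : ∀ c, p {c} = ENNReal.ofReal (Real.exp (a c) / ∑ j, Real.exp (a j)) := by
    intro c
    rw [Measure.map_apply heval (measurableSet_singleton c)]
    have h := hν {1} fun _ => c
    rw [Finset.prod_singleton] at h
    rw [← h]
    congr 1
    ext x
    simp
  have hν' : ∀ (F : Finset G) (c : G → Fin k),
      ν {x | ∀ s ∈ F, x s = c s} = ∏ s ∈ F, p {c s} := by
    simpa only [hp] using hν
  have hp' : ∀ c, p.real {c} = Real.exp (a c) / ∑ j, Real.exp (a j) := fun c => by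
    rw [measureReal_def, hp, ENNReal.toReal_ofReal (by positivity)]
  have hP : PressureInf α f ρ d σ = ((Real.log (∑ j, Real.exp (a j)) : ℝ) : EReal) :=
    le_antisymm (pressureInf_le hρ hα hσ.dim_top hfdef) (pressureInf_ge hρ hα hσ hfdef)
  have hH : MeasEntropy α ν ρ d σ =
      ((Real.log (∑ j, Real.exp (a j)) - ∫ x, f x ∂ν : ℝ) : EReal) :=
    le_antisymm (measEntropy_le hρ hα hσ.dim_top ν (f := fC) hfdef)
      (measEntropy_ge hρ hα hσ p hν' hp' (f := fC) hfdef)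
  refine ⟨hinv, ?_, hP⟩
  rw [hP, hH, ← EReal.coe_add, sub_add_cancel]

end Sofic
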